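/- Let N be a positive integer and L a symmetric positive semidefinite N×N real matrix, and set K = L(L+I)^{−1}. Then K = I − (L+I)^{−1}, and for every subset A ⊆ [N], ∑_{S : A ⊆ S ⊆ [N]} det(L_S) = det(L+I) · det(K_A). In other words, the L-ensemble P_L({A}) = det(L_A)/det(L+I) is a determinantal point process with marginal kernel K = L(L+I)^{−1}. -/

import Mathlib

open Matrix

/-- The principal minor of an `N × N` matrix `L` indexed by a subset `A ⊆ [N]`. -/
noncomputable def pminor {N : ℕ} (L : Matrix (Fin N) (Fin N) ℝ) (A : Finset (Fin N)) : ℝ :=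
  (L.submatrix (fun i : A => (i : Fin N)) (fun j : A => (j : Fin N))).det

/-- Expanding the rows outside `A` of the matrix with rows `L i` for `i ∈ A` and `(L + 1) i`
otherwise gives the sum of the principal minors of `L` over all supersets of `A`. -/
lemma sum_pminor_superset {N : ℕ} (L : Matrix (Fin N) (Fin N) ℝ) (A : Finset (Fin N)) :
    ∑ S ∈ Finset.univ.filter (fun S : Finset (Fin N) => A ⊆ S), pminor L S =
      (Matrix.of (A.piecewise L.row (L + 1).row)).det := by
  have hsplit : (Matrix.of (A.piecewise L.row (L + 1).row)) =
      Matrix.of fun i => L.row i + A.piecewise 0 (1 : Matrix (Fin N) (Fin N) ℝ).row i := by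
    ext i j
    by_cases hi : i ∈ A <;> simp [Finset.piecewise, hi, Matrix.row]
  have hexpand := (detRowAlternating (n := Fin N) (R := ℝ)).map_add_univ L.row
    (A.piecewise 0 (1 : Matrix (Fin N) (Fin N) ℝ).row)
  rw [hsplit]
  refine Eq.trans ?_ hexpand.symm
  rw [Finset.sum_filter]
  refine Finset.sum_congr rfl fun S _ => ?_
  split_ifs with hAS
  · refine (det_piecewise_one_eq_submatrix_det L S).symm.trans ?_
    congr 1
    ext i j
    by_cases hi : i ∈ S
    · simp [Finset.piecewise, hi]
    · have hiA : i ∉ A := fun h => hi (hAS h)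
      simp [Finset.piecewise, hi, hiA]
  · obtain ⟨i, hiA, hiS⟩ := Finset.not_subset.mp hAS
    refine (AlternatingMap.map_coord_zero _ i ?_).symm
    simp [Finset.piecewise, hiA, hiS]

/-- Replacing the rows of `M` in `A` by those of `K * M` multiplies the determinant by the
principal minor of `K` indexed by `A`. -/
lemma det_piecewise_mul_row {N : ℕ} (K M : Matrix (Fin N) (Fin N) ℝ) (A : Finset (Fin N)) :
    (Matrix.of (A.piecewise (K * M).row M.row)).det = M.det * pminor K A := by
  have hmul : Matrix.of (A.piecewise (K * M).row M.row) =
      Matrix.of (A.piecewise K.row (1 : Matrix (Fin N) (Fin N) ℝ).row) * M := by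
    ext i j
    by_cases hi : i ∈ A <;>
      simp [Finset.piecewise, hi, Matrix.row, Matrix.mul_apply, Matrix.one_apply]
  rw [hmul, det_mul, det_piecewise_one_eq_submatrix_det, mul_comm]
  rfl

/-- For symmetric positive semidefinite `L` and `K = L (L + I)⁻¹`, one has
`K = I − (L + I)⁻¹` and `∑_{S ⊇ A} det L_S = det (L + I) · det K_A` for every `A ⊆ [N]`:
the L-ensemble is a determinantal point process with marginal kernel `K`. -/
theorem L_ensemble_is_DPP {N : ℕ} (hN : 0 < N)
    (L : Matrix (Fin N) (Fin N) ℝ) (hsymm : L.IsSymm) (hpsd : L.PosSemidef) :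
    L * (L + 1)⁻¹ = 1 - (L + 1)⁻¹ ∧
    ∀ A : Finset (Fin N),
      (∑ S ∈ Finset.univ.filter (fun S : Finset (Fin N) => A ⊆ S), pminor L S) =
        (L + 1).det * pminor (L * (L + 1)⁻¹) A := by
  have hunit : IsUnit (L + 1).det :=
    (Matrix.isUnit_iff_isUnit_det _).mp (PosDef.posSemidef_add hpsd PosDef.one).isUnit
  refine ⟨?_, fun A => ?_⟩
  · rw [eq_sub_iff_add_eq, ← add_one_mul, mul_nonsing_inv _ hunit]
  · rw [sum_pminor_superset, ← det_piecewise_mul_row, nonsing_inv_mul_cancel_right _ _ hunit]
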